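/- arXiv:2108.12879 — 7 statements merged into one kernel-verified Lean document; each statement's English description precedes it below -/
import Mathlib

section
/- Let G be a finite simple graph with edge weights w : E(G) → ℚ whose vertex set is partitioned into two sets A and B, and let X be the set of edges of G with one endpoint in A and one endpoint in B. Then PerfMatch(G) = Σ_T (∏_{e ∈ T} w(e)) · PerfMatch(G[A] − V(T)) · PerfMatch(G[B] − V(T)), where the sum ranges over all subsets T ⊆ X whose edges are pairwise vertex-disjoint, G[A] and G[B] denote the induced subgraphs on A and B, and V(T) denotes the set of endpoints of edges in T. -/
open scoped Classical

/-- A perfect matching of the vertex set `s` inside `G`: a set of edges of `G`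
with all endpoints in `s`, such that every vertex of `s` lies in exactly one edge.
This describes the perfect matchings of the induced subgraph `G[s]`. -/
def IsPerfectMatchingOn {V : Type*} (G : SimpleGraph V) (s : Set V)
    (M : Finset (Sym2 V)) : Prop :=
  (∀ e ∈ M, e ∈ G.edgeSet ∧ ∀ v ∈ e, v ∈ s) ∧ (∀ v ∈ s, ∃! e, e ∈ M ∧ v ∈ e)

/-- The weighted perfect matching sum of the induced subgraph `G[s]`. -/
noncomputable def PerfMatchOn {V : Type*} [Fintype V] [DecidableEq V]
    (G : SimpleGraph V) (w : Sym2 V → ℚ) (s : Set V) : ℚ :=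
  ∑ M : Finset (Sym2 V), if IsPerfectMatchingOn G s M then ∏ e ∈ M, w e else 0

namespace IsPerfectMatchingOn

variable {V : Type*} {G : SimpleGraph V} {s : Set V} {M : Finset (Sym2 V)}

theorem eq_of_mem (h : IsPerfectMatchingOn G s M) {e f : Sym2 V} {v : V} (he : e ∈ M)
    (hf : f ∈ M) (hve : v ∈ e) (hvf : v ∈ f) : e = f :=
  (h.2 v ((h.1 e he).2 v hve)).unique ⟨he, hve⟩ ⟨hf, hvf⟩

/-- The edges of a perfect matching contained in `A` match the vertices of `A` that are not
covered by the other edges meeting `A`. -/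
theorem filter_subset {A : Set V} {T : Finset (Sym2 V)}
    [DecidablePred fun e : Sym2 V => ∀ v ∈ e, v ∈ A]
    (h : IsPerfectMatchingOn G Set.univ M) (hT : T ⊆ M)
    (hcover : ∀ e ∈ M, ∀ v ∈ e, v ∈ A → e ∈ T ∨ ∀ u ∈ e, u ∈ A)
    (hTA : ∀ e ∈ T, ¬ ∀ v ∈ e, v ∈ A) :
    IsPerfectMatchingOn G (A \ {v | ∃ e ∈ T, v ∈ e}) (M.filter fun e => ∀ v ∈ e, v ∈ A) := by
  refine ⟨fun e he => ?_, fun v hv => ?_⟩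
  · rw [Finset.mem_filter] at he
    refine ⟨(h.1 e he.1).1, fun v hv => ⟨he.2 v hv, ?_⟩⟩
    rintro ⟨f, hf, hvf⟩
    exact hTA f hf (h.eq_of_mem he.1 (hT hf) hv hvf ▸ he.2)
  · obtain ⟨e, ⟨he, hve⟩, huniq⟩ := h.2 v (Set.mem_univ v)
    refine ⟨e, ⟨Finset.mem_filter.2 ⟨he, ?_⟩, hve⟩, fun f hf =>
      huniq f ⟨(Finset.mem_filter.1 hf.1).1, hf.2⟩⟩
    exact (hcover e he v hve hv.1).resolve_left fun heT => hv.2 ⟨e, heT, hve⟩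

/-- Perfect matchings of what a matching `T` leaves uncovered in `A` and `B` extend `T` to a
perfect matching. -/
theorem union [DecidableEq V] {A B : Set V} {T M₁ M₂ : Finset (Sym2 V)}
    (hunion : A ∪ B = Set.univ) (hdisj : Disjoint A B) (hTG : ∀ e ∈ T, e ∈ G.edgeSet)
    (hT : ∀ e ∈ T, ∀ f ∈ T, e ≠ f → ∀ v, v ∈ e → v ∉ f)
    (h₁ : IsPerfectMatchingOn G (A \ {v | ∃ e ∈ T, v ∈ e}) M₁)
    (h₂ : IsPerfectMatchingOn G (B \ {v | ∃ e ∈ T, v ∈ e}) M₂) :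
    IsPerfectMatchingOn G Set.univ (T ∪ (M₁ ∪ M₂)) := by
  have hAB : ∀ v, v ∈ A → v ∉ B := fun _ hv => Set.disjoint_left.1 hdisj hv
  refine ⟨fun e he => ⟨?_, fun _ _ => Set.mem_univ _⟩, fun v _ => ?_⟩
  · rcases Finset.mem_union.1 he with he | he
    · exact hTG e he
    · rcases Finset.mem_union.1 he with he | he
      exacts [(h₁.1 e he).1, (h₂.1 e he).1]
  · have hv : v ∈ A ∨ v ∈ B := by
      rw [← Set.mem_union, hunion]; trivial
    have h₁v : ∀ e ∈ M₁, v ∈ e → v ∈ A ∧ ¬ ∃ e ∈ T, v ∈ e := fun e he => (h₁.1 e he).2 v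
    have h₂v : ∀ e ∈ M₂, v ∈ e → v ∈ B ∧ ¬ ∃ e ∈ T, v ∈ e := fun e he => (h₂.1 e he).2 v
    by_cases hvT : ∃ e ∈ T, v ∈ e
    · obtain ⟨e, he, hve⟩ := hvT
      exact ⟨e, by grind⟩
    · rcases hv with hv | hv
      · obtain ⟨e, he, huniq⟩ := h₁.2 v ⟨hv, hvT⟩
        exact ⟨e, by grind⟩
      · obtain ⟨e, he, huniq⟩ := h₂.2 v ⟨hv, hvT⟩
        exact ⟨e, by grind⟩

end IsPerfectMatchingOn

theorem PerfMatchOn_eq_sum_filter {V : Type*} [Fintype V] [DecidableEq V]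
    (G : SimpleGraph V) (w : Sym2 V → ℚ) (s : Set V) :
    PerfMatchOn G w s =
      ∑ M ∈ Finset.univ.filter (IsPerfectMatchingOn G s), ∏ e ∈ M, w e := by
  rw [PerfMatchOn, Finset.sum_filter]

theorem exists_eq_mk_iff_of_partition {V : Type*} {A B : Set V}
    (hunion : A ∪ B = Set.univ) (hdisj : Disjoint A B) (e : Sym2 V) :
    (∃ x ∈ A, ∃ y ∈ B, e = s(x, y)) ↔ (¬ ∀ v ∈ e, v ∈ A) ∧ ¬ ∀ v ∈ e, v ∈ B := by
  have hAB : ∀ v, v ∈ A → v ∉ B := fun _ hv => Set.disjoint_left.1 hdisj hv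
  have hor : ∀ v, v ∈ A ∨ v ∈ B := fun v => by rw [← Set.mem_union, hunion]; trivial
  constructor
  · rintro ⟨x, hx, y, hy, rfl⟩
    simp only [Sym2.mem_iff, forall_eq_or_imp, forall_eq]
    grind
  · induction e with | _ a b
    simp only [Sym2.mem_iff, forall_eq_or_imp, forall_eq]
    intro h
    rcases hor a with ha | ha
    · exact ⟨a, ha, b, by grind, rfl⟩
    · exact ⟨b, by grind, a, ha, Sym2.eq_swap⟩

/-- Splitting `PerfMatch(G)` along a partition of the vertices into `A` and `B`:
summing over all sets `T` of pairwise vertex-disjoint `A`-`B`-crossing edges, we get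
`PerfMatch(G) = Σ_T (Π_{e ∈ T} w(e)) · PerfMatch(G[A] − V(T)) · PerfMatch(G[B] − V(T))`. -/
theorem perfmatch_partition {V : Type*} [Fintype V] [DecidableEq V]
    (G : SimpleGraph V) (w : Sym2 V → ℚ) (A B : Set V)
    (hunion : A ∪ B = Set.univ) (hdisj : Disjoint A B) :
    PerfMatchOn G w Set.univ =
      ∑ T ∈ Finset.univ.filter (fun T : Finset (Sym2 V) =>
          (∀ e ∈ T, e ∈ G.edgeSet ∧ ∃ x ∈ A, ∃ y ∈ B, e = s(x, y)) ∧
          (∀ e ∈ T, ∀ f ∈ T, e ≠ f → ∀ v, v ∈ e → v ∉ f)),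
        (∏ e ∈ T, w e) *
          PerfMatchOn G w (A \ {v | ∃ e ∈ T, v ∈ e}) *
          PerfMatchOn G w (B \ {v | ∃ e ∈ T, v ∈ e}) := by
  have hAB : ∀ v, v ∈ A → v ∉ B := fun _ hv => Set.disjoint_left.1 hdisj hv
  have hne : ∀ e : Sym2 V, ∃ v, v ∈ e := fun e => ⟨_, e.out_fst_mem⟩
  have hexcl : ∀ e : Sym2 V, (∀ v ∈ e, v ∈ A) → ¬ ∀ v ∈ e, v ∈ B := fun e h h' =>
    (hne e).elim fun v hv => hAB v (h v hv) (h' v hv)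
  simp only [PerfMatchOn_eq_sum_filter, mul_assoc, exists_eq_mk_iff_of_partition hunion hdisj]
  simp only [Finset.sum_mul_sum, ← Finset.sum_product']
  simp only [Finset.mul_sum, Finset.sum_sigma']
  refine Finset.sum_nbij'
    (fun M => ⟨M.filter fun e => (¬ ∀ v ∈ e, v ∈ A) ∧ ¬ ∀ v ∈ e, v ∈ B,
      M.filter fun e => ∀ v ∈ e, v ∈ A, M.filter fun e => ∀ v ∈ e, v ∈ B⟩)
    (fun p => p.1 ∪ (p.2.1 ∪ p.2.2)) ?_ ?_ ?_ ?_ ?_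
  · intro M hM
    simp only [Finset.mem_filter, Finset.mem_univ, true_and] at hM
    simp only [Finset.mem_sigma, Finset.mem_product, Finset.mem_filter, Finset.mem_univ, true_and]
    refine ⟨⟨fun e he => ⟨(hM.1 e he.1).1, he.2⟩, fun e he f hf hef v hve hvf =>
      hef (hM.eq_of_mem he.1 hf.1 hve hvf)⟩, ?_, ?_⟩
    · simpa only [Finset.mem_filter] using hM.filter_subset (A := A)
        (Finset.filter_subset (fun e => (¬ ∀ v ∈ e, v ∈ A) ∧ ¬ ∀ v ∈ e, v ∈ B) M)
        (by grind) (by grind)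
    · simpa only [Finset.mem_filter] using hM.filter_subset (A := B)
        (Finset.filter_subset (fun e => (¬ ∀ v ∈ e, v ∈ A) ∧ ¬ ∀ v ∈ e, v ∈ B) M)
        (by grind) (by grind)
  · rintro ⟨T, M₁, M₂⟩ h
    simp only [Finset.mem_sigma, Finset.mem_product, Finset.mem_filter, Finset.mem_univ,
      true_and] at h ⊢
    exact .union hunion hdisj (fun e he => (h.1.1 e he).1) h.1.2 h.2.1 h.2.2
  · intro M _
    ext e
    simp only [Finset.mem_union, Finset.mem_filter]
    tauto
  · rintro ⟨T, M₁, M₂⟩ h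
    simp only [Finset.mem_sigma, Finset.mem_product, Finset.mem_filter, Finset.mem_univ,
      true_and] at h
    have h₁ : ∀ e ∈ M₁, ∀ v ∈ e, v ∈ A := fun e he v hv => ((h.2.1.1 e he).2 v hv).1
    have h₂ : ∀ e ∈ M₂, ∀ v ∈ e, v ∈ B := fun e he v hv => ((h.2.2.1 e he).2 v hv).1
    have hT := fun e he => (h.1.1 e he).2
    have hT' : (T ∪ (M₁ ∪ M₂)).filter (fun e => (¬ ∀ v ∈ e, v ∈ A) ∧ ¬ ∀ v ∈ e, v ∈ B) = T := by
      ext e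
      simp only [Finset.mem_union, Finset.mem_filter]
      have := hT e; have := h₁ e; have := h₂ e; tauto
    have hM₁ : (T ∪ (M₁ ∪ M₂)).filter (fun e => ∀ v ∈ e, v ∈ A) = M₁ := by
      ext e
      simp only [Finset.mem_union, Finset.mem_filter]
      have := hT e; have := h₁ e; have := h₂ e; have := hexcl e; tauto
    have hM₂ : (T ∪ (M₁ ∪ M₂)).filter (fun e => ∀ v ∈ e, v ∈ B) = M₂ := by
      ext e
      simp only [Finset.mem_union, Finset.mem_filter]
      have := hT e; have := h₁ e; have := h₂ e; have := hexcl e; tauto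
    simp only [hT', hM₁, hM₂]
  · intro M _
    have hd : Disjoint (M.filter fun e => ∀ v ∈ e, v ∈ A) (M.filter fun e => ∀ v ∈ e, v ∈ B) :=
      Finset.disjoint_filter.2 fun e _ => hexcl e
    have hd' : Disjoint (M.filter fun e => (¬ ∀ v ∈ e, v ∈ A) ∧ ¬ ∀ v ∈ e, v ∈ B)
        ((M.filter fun e => ∀ v ∈ e, v ∈ A) ∪ M.filter fun e => ∀ v ∈ e, v ∈ B) := by
      rw [← Finset.filter_or]
      exact Finset.disjoint_filter.2 fun e _ he => not_or.2 he
    rw [← Finset.prod_union hd, ← Finset.prod_union hd']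
    refine Finset.prod_congr ?_ fun _ _ => rfl
    ext e
    simp only [Finset.mem_union, Finset.mem_filter]
    tauto
end

section
/- For any graphs G and G' whose common vertex set S = V(G) ∩ V(G') induces a clique in both G and G', and any clique-sum G ⊕_S G', the Hadwiger number satisfies η(G ⊕_S G') ≤ max{η(G), η(G')}. -/
/-- A minor model of `H` in `G`. -/
def IsMinorModel {α β : Type*} (H : SimpleGraph α) (G : SimpleGraph β)
    (S : α → Set β) : Prop :=
  (∀ a, (G.induce (S a)).Connected) ∧
  (Pairwise fun a b => Disjoint (S a) (S b)) ∧
  (∀ a b, H.Adj a b → ∃ x ∈ S a, ∃ y ∈ S b, G.Adj x y)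

/-- `H` is a minor of `G`. -/
def IsMinor {α β : Type*} (H : SimpleGraph α) (G : SimpleGraph β) : Prop :=
  ∃ S : α → Set β, IsMinorModel H G S

/-- The Hadwiger number: the largest `k` such that `K_k` is a minor of `G`. -/
noncomputable def hadwiger {β : Type*} (G : SimpleGraph β) : ℕ :=
  sSup {k : ℕ | IsMinor (⊤ : SimpleGraph (Fin k)) G}

namespace SimpleGraph

variable {V : Type*} {G G' H : SimpleGraph V} {A B T : Set V}

/-- In a subgraph `H` of the union of a graph on `A` and a graph on `B` glued along a clique,
every vertex joined inside `T` to a vertex `u` of `A` can be traced back to a vertex reachable from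
`u` inside `T ∩ A`. -/
theorem exists_reachable_induce_inter_of_le_sup (hGA : ∀ u v, G.Adj u v → u ∈ A ∧ v ∈ A)
    (hG'B : ∀ u v, G'.Adj u v → u ∈ B ∧ v ∈ B) (hclique : G.IsClique (A ∩ B))
    (hle : H ≤ G ⊔ G') {u v : T} (hu : u.1 ∈ A) (huv : (H.induce T).Reachable u v) :
    ∃ w : ↥(T ∩ A), (G.induce (T ∩ A)).Reachable ⟨u, u.2, hu⟩ w ∧
      (v.1 = w.1 ∨ v.1 ∉ A ∧ w.1 ∈ B) := by
  rw [reachable_iff_reflTransGen] at huv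
  induction huv with
  | refl => exact ⟨⟨u, u.2, hu⟩, Reachable.refl _, Or.inl rfl⟩
  | @tail x y _ hxy ih =>
    obtain ⟨w, hw, hxw⟩ := ih
    rcases hle hxy with hG | hG'
    · obtain ⟨hxA, hyA⟩ := hGA _ _ hG
      have hxw : x.1 = w.1 := hxw.resolve_right fun h => h.1 hxA
      refine ⟨⟨y, y.2, hyA⟩, hw.trans (Adj.reachable ?_), Or.inl rfl⟩
      change G.Adj w.1 y.1
      exact hxw ▸ hG
    · obtain ⟨hxB, hyB⟩ := hG'B _ _ hG'
      have hwB : w.1 ∈ B := hxw.elim (fun h => h ▸ hxB) And.right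
      by_cases hyA : y.1 ∈ A
      · by_cases hwy : w.1 = y.1
        · exact ⟨w, hw, Or.inl hwy.symm⟩
        · refine ⟨⟨y, y.2, hyA⟩, hw.trans (Adj.reachable ?_), Or.inl rfl⟩
          exact hclique ⟨w.2.2, hwB⟩ ⟨hyA, hyB⟩ hwy
      · exact ⟨w, hw, Or.inr ⟨hyA, hwB⟩⟩

end SimpleGraph

/-- A minor model in a clique-sum whose branch sets all meet `A` restricts to a
minor model in the summand on `A`. -/
theorem IsMinorModel.inter_of_le_sup {V α : Type*} {G G' H : SimpleGraph V} {A B : Set V}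
    {K : SimpleGraph α} {T : α → Set V} (hT : IsMinorModel K H T)
    (hGA : ∀ u v, G.Adj u v → u ∈ A ∧ v ∈ A) (hG'B : ∀ u v, G'.Adj u v → u ∈ B ∧ v ∈ B)
    (hclique : G.IsClique (A ∩ B)) (hle : H ≤ G ⊔ G') (hmeet : ∀ a, (T a ∩ A).Nonempty) :
    IsMinorModel K G fun a => T a ∩ A := by
  obtain ⟨hconn, hdisj, hadj⟩ := hT
  have key : ∀ a (u v : T a) (hu : u.1 ∈ A), ∃ w : ↥(T a ∩ A),
      (G.induce (T a ∩ A)).Reachable ⟨u, u.2, hu⟩ w ∧ (v.1 = w.1 ∨ v.1 ∉ A ∧ w.1 ∈ B) :=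
    fun a u v hu => SimpleGraph.exists_reachable_induce_inter_of_le_sup hGA hG'B hclique hle hu
      ((hconn a).preconnected u v)
  have touch : ∀ a, ∀ x ∈ T a, x ∈ B → ∃ w ∈ T a ∩ A, w ∈ B := by
    intro a x hx hxB
    obtain ⟨u, hu⟩ := hmeet a
    obtain ⟨w, -, h⟩ := key a ⟨u, hu.1⟩ ⟨x, hx⟩ hu.2
    exact ⟨w.1, w.2, h.elim (fun h => h ▸ hxB) And.right⟩
  refine ⟨fun a => ?_, fun a b hab => (hdisj hab).mono Set.inter_subset_left Set.inter_subset_left,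
    fun a b hab => ?_⟩
  · have := (hmeet a).to_subtype
    refine ⟨fun u v => ?_⟩
    obtain ⟨w, hw, h⟩ := key a ⟨u, u.2.1⟩ ⟨v, v.2.1⟩ u.2.2
    have hvw : v = w := Subtype.ext (h.resolve_right fun h => h.1 v.2.2)
    exact hvw ▸ hw
  · obtain ⟨x, hx, y, hy, hxy⟩ := hadj a b hab
    rcases hle hxy with hG | hG'
    · obtain ⟨hxA, hyA⟩ := hGA _ _ hG
      exact ⟨x, ⟨hx, hxA⟩, y, ⟨hy, hyA⟩, hG⟩
    · obtain ⟨hxB, hyB⟩ := hG'B _ _ hG'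
      obtain ⟨p, hp, hpB⟩ := touch a x hx hxB
      obtain ⟨q, hq, hqB⟩ := touch b y hy hyB
      exact ⟨p, hp, q, hq, hclique ⟨hp.2, hpB⟩ ⟨hq.2, hqB⟩
        ((hdisj hab.ne).ne_of_mem hp.1 hq.1)⟩

theorem bddAbove_setOf_isMinor_top {V : Type*} [Finite V] (G : SimpleGraph V) :
    BddAbove {k : ℕ | IsMinor (⊤ : SimpleGraph (Fin k)) G} := by
  refine ⟨Nat.card V, ?_⟩
  rintro k ⟨T, hconn, hdisj, -⟩
  choose f hf using fun a => Set.nonempty_coe_sort.mp (hconn a).nonempty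
  have hinj : Function.Injective f := fun a b hab => by
    by_contra hne
    exact (hdisj hne).ne_of_mem (hf a) (hf b) hab
  simpa using Nat.card_le_card_of_injective f hinj

theorem le_hadwiger_of_isMinor {V : Type*} [Finite V] {G : SimpleGraph V} {k : ℕ}
    (h : IsMinor (⊤ : SimpleGraph (Fin k)) G) : k ≤ hadwiger G :=
  le_csSup (bddAbove_setOf_isMinor_top G) h

/-- Clique-sums do not increase the Hadwiger number.
Here `G` and `G'` are graphs on vertex sets `A` and `B` inside a common ambient vertex
type with `A ∪ B` the full vertex set, `S = A ∩ B` is a clique in both, and the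
clique-sum `H` is obtained from the union `G ⊔ G'` by deleting some edges inside `A ∩ B`. -/
theorem hadwiger_cliqueSum {V : Type*} [Fintype V] (G G' H : SimpleGraph V) (A B : Set V)
    (hGA : ∀ u v, G.Adj u v → u ∈ A ∧ v ∈ A)
    (hG'B : ∀ u v, G'.Adj u v → u ∈ B ∧ v ∈ B)
    (hunion : A ∪ B = Set.univ)
    (hcliqueG : G.IsClique (A ∩ B)) (hcliqueG' : G'.IsClique (A ∩ B))
    (hle : H ≤ G ⊔ G')
    (hdel : ∀ u v, (G ⊔ G').Adj u v → ¬ H.Adj u v → u ∈ A ∩ B ∧ v ∈ A ∩ B) :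
    hadwiger H ≤ max (hadwiger G) (hadwiger G') := by
  refine csSup_le' ?_
  rintro k ⟨T, hT⟩
  by_cases hA : ∀ a, (T a ∩ A).Nonempty
  · exact le_max_of_le_left
      (le_hadwiger_of_isMinor ⟨_, hT.inter_of_le_sup hGA hG'B hcliqueG hle hA⟩)
  by_cases hB : ∀ a, (T a ∩ B).Nonempty
  · rw [Set.inter_comm] at hcliqueG'
    rw [sup_comm] at hle
    exact le_max_of_le_right
      (le_hadwiger_of_isMinor ⟨_, hT.inter_of_le_sup hG'B hGA hcliqueG' hle hB⟩)
  push Not at hA hB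
  obtain ⟨a, ha⟩ := hA
  obtain ⟨b, hb⟩ := hB
  rw [← Set.disjoint_iff_inter_eq_empty, Set.disjoint_left] at ha hb
  have hab : a ≠ b := by
    rintro rfl
    obtain ⟨x, hx⟩ := Set.nonempty_coe_sort.mp (hT.1 a).nonempty
    have hxAB : x ∈ A ∪ B := hunion ▸ Set.mem_univ x
    exact hxAB.elim (ha hx) (hb hx)
  obtain ⟨x, hx, y, hy, hxy⟩ := hT.2.2 a b hab
  rcases hle hxy with hG | hG'
  · exact absurd (hGA _ _ hG).1 (ha hx)
  · exact absurd (hG'B _ _ hG').2 (hb hy)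
end

section
/- Let G'' = G ⊕_S G' be a clique-sum of graphs G and G' along the clique S = V(G) ∩ V(G'), let t ≥ 1, and let (S_1, …, S_t) be a minor model of the complete graph K_t in G''. Then either every branch set S_i intersects V(G), or every branch set S_i intersects V(G'). -/
/-- In a clique-sum `H` of `G` (on vertex set `A`) and `G'` (on vertex set `B`)
along the clique `A ∩ B`, any minor model of `K_t` (for `t ≥ 1`) has either all of
its branch sets intersecting `A`, or all of its branch sets intersecting `B`. -/
theorem cliqueSum_minorModel_side {V : Type*} [Fintype V] (G G' H : SimpleGraph V)
    (A B : Set V)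
    (hGA : ∀ u v, G.Adj u v → u ∈ A ∧ v ∈ A)
    (hG'B : ∀ u v, G'.Adj u v → u ∈ B ∧ v ∈ B)
    (hunion : A ∪ B = Set.univ)
    (hcliqueG : G.IsClique (A ∩ B)) (hcliqueG' : G'.IsClique (A ∩ B))
    (hle : H ≤ G ⊔ G')
    (hdel : ∀ u v, (G ⊔ G').Adj u v → ¬ H.Adj u v → u ∈ A ∩ B ∧ v ∈ A ∩ B)
    (t : ℕ) (ht : 1 ≤ t) (S : Fin t → Set V)
    (hS : IsMinorModel (⊤ : SimpleGraph (Fin t)) H S) :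
    (∀ i, (S i ∩ A).Nonempty) ∨ (∀ i, (S i ∩ B).Nonempty) := by
  by_contra! h
  obtain ⟨⟨i, hi⟩, j, hj⟩ := h
  obtain ⟨hconn, -, hadj⟩ := hS
  have notMem_A : ∀ x ∈ S i, x ∉ A := fun x hx hxA =>
    Set.eq_empty_iff_forall_notMem.mp hi x ⟨hx, hxA⟩
  have notMem_B : ∀ x ∈ S j, x ∉ B := fun x hx hxB =>
    Set.eq_empty_iff_forall_notMem.mp hj x ⟨hx, hxB⟩
  have hij : i ≠ j := by
    rintro rfl
    obtain ⟨x, hx⟩ := (hconn i).nonempty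
    have hxAB : x ∈ A ∪ B := hunion ▸ Set.mem_univ x
    exact hxAB.elim (notMem_A x hx) (notMem_B x hx)
  obtain ⟨x, hx, y, hy, hxy⟩ := hadj i j hij
  rcases hle hxy with hG | hG'
  · exact notMem_A x hx (hGA x y hG).1
  · exact notMem_B y hy (hG'B x y hG').2
end

section
/- Let G'' = G ⊕_S G' be a clique-sum of graphs G and G' along the clique S = V(G) ∩ V(G'), and suppose (S_1, …, S_t) is a minor model of the complete graph K_t in G'' such that every branch set S_i intersects V(G). Then K_t is a minor of G. -/
/-- If every edge of `H` is an edge of `G` inside `A` or has both ends in `B`, and `A ∩ B` is a clique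
of `G`, then a walk of `H` in `S` ending at `v ∈ A` yields reachability of `v` in `G` within `S ∩ A`,
either from its start or, if the start is not in `A`, from some vertex of `A ∩ B`. -/
lemma reachable_induce_inter_of_walk {V : Type*} {G H : SimpleGraph V} {A B S : Set V}
    (hclique : G.IsClique (A ∩ B))
    (hadj : ∀ u v, H.Adj u v → (G.Adj u v ∧ u ∈ A ∧ v ∈ A) ∨ (u ∈ B ∧ v ∈ B))
    {w v : S} (p : (H.induce S).Walk w v) (hv : (v : V) ∈ A) :
    (∀ hw : (w : V) ∈ A,
      (G.induce (S ∩ A)).Reachable ⟨w, w.2, hw⟩ ⟨v, v.2, hv⟩) ∧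
    ((w : V) ∉ A → ∃ (s : V) (hs : s ∈ S ∩ A), s ∈ B ∧
      (G.induce (S ∩ A)).Reachable ⟨s, hs⟩ ⟨v, v.2, hv⟩) := by
  have clique_reachable : ∀ x y (hx : x ∈ S ∩ A) (hy : y ∈ S ∩ A), x ∈ B → y ∈ B →
      (G.induce (S ∩ A)).Reachable ⟨x, hx⟩ ⟨y, hy⟩ := by
    intro x y hx hy hxB hyB
    by_cases hxy : x = y
    · subst hxy
      exact .refl _
    · exact SimpleGraph.Adj.reachable
        (SimpleGraph.induce_adj.2 (hclique ⟨hx.2, hxB⟩ ⟨hy.2, hyB⟩ hxy))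
  induction p with
  | nil => exact ⟨fun _ => .refl _, fun hw => absurd hv hw⟩
  | @cons w x v h p ih =>
    obtain ⟨ih_mem, ih_notMem⟩ := ih hv
    rcases hadj _ _ (SimpleGraph.induce_adj.1 h) with ⟨hG, hwA, hxA⟩ | ⟨hwB, hxB⟩
    · refine ⟨fun hw => ?_, fun hw => absurd hwA hw⟩
      have hstep : (G.induce (S ∩ A)).Adj ⟨w, w.2, hw⟩ ⟨x, x.2, hxA⟩ := SimpleGraph.induce_adj.2 hG
      exact hstep.reachable.trans (ih_mem hxA)
    · obtain ⟨s, hs, hsB, hr⟩ : ∃ (s : V) (hs : s ∈ S ∩ A), s ∈ B ∧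
          (G.induce (S ∩ A)).Reachable ⟨s, hs⟩ ⟨v, v.2, hv⟩ := by
        by_cases hxA : (x : V) ∈ A
        · exact ⟨x, ⟨x.2, hxA⟩, hxB, ih_mem hxA⟩
        · exact ih_notMem hxA
      exact ⟨fun hw => (clique_reachable w s ⟨w.2, hw⟩ hs hwB hsB).trans hr,
        fun _ => ⟨s, hs, hsB, hr⟩⟩

/-- In a clique-sum `H` of `G` (on vertex set `A`) and `G'` (on vertex set `B`)
along the clique `A ∩ B`, if a minor model of `K_t` has every branch set
intersecting `A`, then `K_t` is a minor of `G`. -/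
theorem cliqueSum_minor_of_side {V : Type*} [Fintype V] (G G' H : SimpleGraph V)
    (A B : Set V)
    (hGA : ∀ u v, G.Adj u v → u ∈ A ∧ v ∈ A)
    (hG'B : ∀ u v, G'.Adj u v → u ∈ B ∧ v ∈ B)
    (hunion : A ∪ B = Set.univ)
    (hcliqueG : G.IsClique (A ∩ B)) (hcliqueG' : G'.IsClique (A ∩ B))
    (hle : H ≤ G ⊔ G')
    (hdel : ∀ u v, (G ⊔ G').Adj u v → ¬ H.Adj u v → u ∈ A ∩ B ∧ v ∈ A ∩ B)
    (t : ℕ) (S : Fin t → Set V)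
    (hS : IsMinorModel (⊤ : SimpleGraph (Fin t)) H S)
    (hside : ∀ i, (S i ∩ A).Nonempty) :
    IsMinor (⊤ : SimpleGraph (Fin t)) G := by
  have hadj : ∀ u v, H.Adj u v → (G.Adj u v ∧ u ∈ A ∧ v ∈ A) ∨ (u ∈ B ∧ v ∈ B) :=
    fun u v h => (hle h).imp (fun hG => ⟨hG, hGA u v hG⟩) (hG'B u v)
  obtain ⟨hconn, hdisj, hedge⟩ := hS
  have meets_clique : ∀ i, ∀ x ∈ S i, x ∈ B → ∃ s ∈ S i ∩ A, s ∈ B := by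
    intro i x hx hxB
    by_cases hxA : x ∈ A
    · exact ⟨x, ⟨hx, hxA⟩, hxB⟩
    · obtain ⟨v, hv, hvA⟩ := hside i
      obtain ⟨p⟩ := (hconn i).preconnected ⟨x, hx⟩ ⟨v, hv⟩
      obtain ⟨s, hs, hsB, -⟩ := (reachable_induce_inter_of_walk hcliqueG hadj p hvA).2 hxA
      exact ⟨s, hs, hsB⟩
  refine ⟨fun i => S i ∩ A, fun i => ?_, fun i j hij => ?_, fun i j hij => ?_⟩
  · have : Nonempty ↥(S i ∩ A) := (hside i).to_subtype
    refine ⟨fun u v => ?_⟩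
    obtain ⟨p⟩ := (hconn i).preconnected ⟨u, u.2.1⟩ ⟨v, v.2.1⟩
    exact (reachable_induce_inter_of_walk hcliqueG hadj p v.2.2).1 u.2.2
  · exact (hdisj hij).mono Set.inter_subset_left Set.inter_subset_left
  · obtain ⟨x, hx, y, hy, hxy⟩ := hedge i j hij
    rcases hadj x y hxy with ⟨hG, hxA, hyA⟩ | ⟨hxB, hyB⟩
    · exact ⟨x, ⟨hx, hxA⟩, y, ⟨hy, hyA⟩, hG⟩
    · obtain ⟨p, hp, hpB⟩ := meets_clique i x hx hxB
      obtain ⟨q, hq, hqB⟩ := meets_clique j y hy hyB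
      exact ⟨p, hp, q, hq, hcliqueG ⟨hp.2, hpB⟩ ⟨hq.2, hqB⟩ fun hpq =>
        Set.disjoint_left.1 (hdisj hij.ne) hp.1 (hpq ▸ hq.1)⟩
end

section
/- Let G be a finite simple graph with exactly 9 vertices and at most 30 edges such that every vertex of G has degree at least 6 and every two adjacent vertices of G have at least two common neighbors (i.e., every edge of G is contained in a K_4-subgraph). Then the complete graph K_8 is not a minor of G. -/
open Finset in
/-- If all pairs of distinct vertices outside `{x, y}` are adjacent, then every non-edge is incident
with `x` or `y`. -/
theorem SimpleGraph.choose_two_le_of_isClique_compl_pair {V : Type*} [Fintype V] [DecidableEq V]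
    (G : SimpleGraph V) [DecidableRel G.Adj] {x y : V}
    (h : G.IsClique ({x, y}ᶜ : Set V)) :
    (Fintype.card V).choose 2 ≤ #G.edgeFinset + Gᶜ.degree x + Gᶜ.degree y := by
  rw [← SimpleGraph.card_edgeFinset_top_eq_card_choose_two,
    ← SimpleGraph.card_incidenceFinset_eq_degree, ← SimpleGraph.card_incidenceFinset_eq_degree]
  refine (card_le_card (t := G.edgeFinset ∪ Gᶜ.incidenceFinset x ∪ Gᶜ.incidenceFinset y) ?_).trans
    ((card_union_le _ _).trans (Nat.add_le_add_right (card_union_le _ _) _))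
  intro e
  induction e with | _ u v
  intro he
  have huv : u ≠ v := by simpa using he
  have huv' := @h u
  simp only [mem_union, SimpleGraph.mem_edgeFinset, SimpleGraph.mem_edgeSet,
    SimpleGraph.mem_incidenceFinset, SimpleGraph.mk'_mem_incidenceSet_iff, SimpleGraph.compl_adj]
  simp only [Set.mem_compl_iff, Set.mem_insert_iff, Set.mem_singleton_iff] at huv'
  grind

/-- If the complete graph on `Fin n` is a minor of a graph on `n + 1` vertices, then deleting two
suitable vertices leaves a clique. -/
theorem IsMinor.exists_isClique_compl_pair {V : Type*} [Fintype V] {G : SimpleGraph V} {n : ℕ}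
    [NeZero n] (hV : Fintype.card V = n + 1) (h : IsMinor (⊤ : SimpleGraph (Fin n)) G) :
    ∃ x y, G.IsClique ({x, y}ᶜ : Set V) := by
  classical
  obtain ⟨S, hconn, hdisj, hadj⟩ := h
  have hne (a) : ∃ v, v ∈ S a := let ⟨v⟩ := (hconn a).nonempty; ⟨v, v.2⟩
  choose f hf using hne
  have hS {a b v} (ha : v ∈ S a) (hb : v ∈ S b) : a = b :=
    by_contra fun hab => Set.disjoint_left.1 (hdisj hab) ha hb
  have hinj : Function.Injective f := fun a b hab => hS (hf a) (hab ▸ hf b)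
  have hcard : (Finset.univ.image f)ᶜ.card = 1 := by
    rw [Finset.card_compl, Finset.card_image_of_injective _ hinj, hV]
    simp
  obtain ⟨y, hy⟩ := Finset.card_eq_one.1 hcard
  have hy' (v) : v = y ∨ ∃ a, f a = v := by
    have := Finset.ext_iff.1 hy v
    simp only [Finset.mem_compl, Finset.mem_image, Finset.mem_univ, true_and,
      Finset.mem_singleton] at this
    tauto
  obtain ⟨a, ha⟩ : ∃ a, ∀ b, y ∈ S b → b = a := by
    by_cases hyS : ∃ a, y ∈ S a
    · exact hyS.imp fun a hya b hyb => hS hyb hya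
    · exact ⟨0, fun b hyb => (hyS ⟨b, hyb⟩).elim⟩
  have hsingle {b v} (hb : b ≠ a) (hv : v ∈ S b) : v = f b := by
    obtain rfl | ⟨c, rfl⟩ := hy' v
    · exact (hb (ha b hv)).elim
    · rw [hS (hf c) hv]
  refine ⟨f a, y, fun u hu v hv huv => ?_⟩
  simp only [Set.mem_compl_iff, Set.mem_insert_iff, Set.mem_singleton_iff, not_or] at hu hv
  obtain ⟨b, rfl⟩ := (hy' u).resolve_left hu.2
  obtain ⟨c, rfl⟩ := (hy' v).resolve_left hv.2
  obtain ⟨p, hp, q, hq, hpq⟩ := hadj b c (ne_of_apply_ne f huv)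
  rwa [hsingle (ne_of_apply_ne f hu.1) hp, hsingle (ne_of_apply_ne f hv.1) hq] at hpq

/-- A graph on `9` vertices with at most `30` edges, minimum degree at least `6`, in which
every two adjacent vertices have at least two common neighbors (every edge lies in a
`K₄`-subgraph), has no `K₈`-minor. -/
theorem no_K8_minor_of_nine_vertices {V : Type*} [Fintype V] [DecidableEq V]
    (G : SimpleGraph V) [DecidableRel G.Adj]
    (h9 : Fintype.card V = 9) (h30 : G.edgeSet.ncard ≤ 30)
    (hdeg : ∀ v : V, 6 ≤ G.degree v)
    (hK4 : ∀ u v : V, G.Adj u v →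
      ∃ a b, a ≠ b ∧ G.Adj u a ∧ G.Adj u b ∧ G.Adj v a ∧ G.Adj v b) :
    ¬ IsMinor (⊤ : SimpleGraph (Fin 8)) G := by
  intro hminor
  obtain ⟨x, y, hxy⟩ := hminor.exists_isClique_compl_pair h9
  have hcount := G.choose_two_le_of_isClique_compl_pair hxy
  rw [← SimpleGraph.coe_edgeFinset, Set.ncard_coe_finset] at h30
  have hx := hdeg x
  have hy := hdeg y
  rw [SimpleGraph.degree_compl, SimpleGraph.degree_compl, h9,
    show Nat.choose 9 2 = 36 from rfl] at hcount
  omega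
end

section
/- Let Z be the 9-vertex graph defined in the context. Then the complete graph K_8 is not a minor of Z; equivalently, the Hadwiger number of Z is at most 7. -/
/-- The vertices of the graph `Z`: `Sum.inl i` is the inner vertex `wᵢ`
and `Sum.inr (i, j)` is the outer (blowup) vertex `oᵢʲ`. -/
abbrev ZVert : Type := Fin 3 ⊕ Fin 3 × Fin 2

/-- Underlying relation for the graph `Z`: all `w`-vertices are mutually adjacent,
all `o`-vertices are mutually adjacent (indices mod 3, so `oᵢʲ oᵢ'ʲ'` for all `i ≠ i'`
together with `oᵢ¹oᵢ²`), and `wᵢ` is adjacent exactly to `oᵢʲ` and `o_{i+1}ʲ`. -/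
def ZRel : ZVert → ZVert → Prop
  | Sum.inl _, Sum.inl _ => True
  | Sum.inl i, Sum.inr p => p.1 = i ∨ p.1 = i + 1
  | Sum.inr _, Sum.inl _ => False
  | Sum.inr _, Sum.inr _ => True

/-- The 9-vertex graph `Z` (the blowup of the triangulated complication-free simple
ring with three inner vertices), a simple graph with 30 edges. -/
def Z : SimpleGraph ZVert := SimpleGraph.fromRel ZRel

/-- Branch sets of a complete minor that are singletons get distinct colours, and every other
branch set uses at least two vertices. -/
theorem IsMinor.two_mul_card_le {α β γ : Type*} [Fintype α] [Fintype β] [Fintype γ]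
    {G : SimpleGraph β} (h : IsMinor (⊤ : SimpleGraph α) G) (C : G.Coloring γ) :
    2 * Fintype.card α ≤ Fintype.card β + Fintype.card γ := by
  obtain ⟨S, hconn, hdisj, hadj⟩ := h
  have hne : ∀ a, ∃ x, x ∈ S a := fun a =>
    Set.nonempty_coe_sort.mp (hconn a).nonempty
  choose f hf using hne
  have hunique : ∀ {a b x}, x ∈ S a → x ∈ S b → a = b := by
    intro a b x ha hb
    by_contra hab
    exact Set.disjoint_left.mp (hdisj hab) ha hb
  have hextra : ∀ a, ∃ z : β ⊕ γ, (∃ x ∈ S a, x ≠ f a ∧ z = Sum.inl x) ∨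
      ((∀ x ∈ S a, x = f a) ∧ z = Sum.inr (C (f a))) := by
    intro a
    by_cases ha : ∀ x ∈ S a, x = f a
    · exact ⟨_, Or.inr ⟨ha, rfl⟩⟩
    · push Not at ha
      obtain ⟨x, hx, hxf⟩ := ha
      exact ⟨_, Or.inl ⟨x, hx, hxf, rfl⟩⟩
  choose g hg using hextra
  have hfg : ∀ a b, Sum.inl (f a) ≠ g b := by
    intro a b hab
    rcases hg b with ⟨x, hx, hxf, hgx⟩ | ⟨-, hgb⟩
    · obtain rfl : f a = x := Sum.inl_injective (hab.trans hgx)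
      exact hxf (congrArg f (hunique (hf a) hx))
    · exact Sum.inl_ne_inr (hab.trans hgb)
  have hinj : Function.Injective (Sum.elim (fun a => Sum.inl (f a)) g : α ⊕ α → β ⊕ γ) := by
    refine Function.Injective.sumElim ?_ ?_ hfg
    · intro a b hab
      exact hunique (hf a) (Sum.inl_injective hab ▸ hf b)
    · intro a b hab
      rcases hg a with ⟨x, hx, -, hgx⟩ | ⟨ha, hga⟩ <;>
        rcases hg b with ⟨y, hy, -, hgy⟩ | ⟨hb, hgb⟩
      · obtain rfl : x = y := Sum.inl_injective (hgx.symm.trans (hab.trans hgy))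
        exact hunique hx hy
      · exact absurd (hgx.symm.trans (hab.trans hgb)) Sum.inl_ne_inr
      · exact absurd (hga.symm.trans (hab.trans hgy)) Sum.inr_ne_inl
      · by_contra hne
        obtain ⟨x, hx, y, hy, hxy⟩ := hadj a b hne
        rw [ha x hx, hb y hy] at hxy
        exact C.valid hxy (Sum.inr_injective (hga.symm.trans (hab.trans hgb)))
  have hcard := Fintype.card_le_of_injective _ hinj
  simpa [two_mul] using hcard

/-- The colouring of `Z` in which `wᵢ` shares its colour with one of its two non-neighbours. -/
def ZColoring : Z.Coloring (Fin 3 × Fin 2) :=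
  SimpleGraph.Coloring.mk (Sum.elim (fun i => (i + 2, 0)) id) (by
    have hsucc : ∀ i : Fin 3, i + 2 ≠ i ∧ i + 2 ≠ i + 1 := by decide
    rintro (i | p) (j | q) hadj heq <;>
      simp only [Z, SimpleGraph.fromRel_adj, ZRel, Sum.elim_inl, Sum.elim_inr, id_eq] at hadj heq
    · simp_all
    · subst heq
      simp [hsucc i] at hadj
    · subst heq
      simp [hsucc j] at hadj
    · simp_all)

theorem card_le_seven_of_isMinor_Z {k : ℕ} (h : IsMinor (⊤ : SimpleGraph (Fin k)) Z) : k ≤ 7 := by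
  have hcard := h.two_mul_card_le ZColoring
  simp only [Fintype.card_sum, Fintype.card_prod, Fintype.card_fin] at hcard
  omega

/-- `K₈` is not a minor of `Z`; equivalently, the Hadwiger number of `Z` is at most `7`. -/
theorem Z_no_K8_minor : ¬ IsMinor (⊤ : SimpleGraph (Fin 8)) Z ∧ hadwiger Z ≤ 7 := by
  refine ⟨fun h => ?_, csSup_le' fun k hk => card_le_seven_of_isMinor_Z hk⟩
  have := card_le_seven_of_isMinor_Z h
  omega
end

section
/- Let Z be the 9-vertex graph defined in the context. Then every minor of Z that has exactly 8 vertices has at most 27 edges. -/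
/-- In a disjoint family of nonempty subsets of a finite type, with one member fewer than the type
has elements, all but at most two elements of the type form a member of the family by themselves. -/
theorem exists_pair_forall_ne_eq_singleton {α β : Type*} [Fintype α] [Fintype β]
    (hcard : Fintype.card β = Fintype.card α + 1) (S : α → Set β)
    (hne : ∀ a, (S a).Nonempty) (hdisj : Pairwise fun a b => Disjoint (S a) (S b)) :
    ∃ x y : β, ∀ v, v ≠ x → v ≠ y → ∃ a, S a = {v} := by
  classical
  choose f hf using hne
  have huniq : ∀ {a b v}, v ∈ S a → v ∈ S b → a = b := fun {a b v} ha hb => by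
    by_contra hab
    exact Set.disjoint_left.1 (hdisj hab) ha hb
  have hinj : Function.Injective f := fun a b hab => huniq (hf a) (hab ▸ hf b)
  have hcompl : (Finset.univ.image f)ᶜ.card = 1 := by
    rw [Finset.card_compl, Finset.card_image_of_injective _ hinj, Finset.card_univ]
    omega
  obtain ⟨x, hx⟩ := Finset.card_eq_one.1 hcompl
  have hrange : ∀ v, v ≠ x → ∃ a, f a = v := fun v hv => by
    by_contra hv'
    have : v ∈ (Finset.univ.image f)ᶜ := by simpa using hv'
    rw [hx] at this
    exact hv (Finset.mem_singleton.1 this)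
  have hsingleton : ∀ a, x ∉ S a → S a = {f a} := fun a ha => by
    refine Set.eq_singleton_iff_unique_mem.2 ⟨hf a, fun u hu => ?_⟩
    obtain ⟨b, rfl⟩ := hrange u (fun h => ha (h ▸ hu))
    rw [huniq hu (hf b)]
  by_cases hcov : ∃ c, x ∈ S c
  · obtain ⟨c, hc⟩ := hcov
    refine ⟨x, f c, fun v hvx hvc => ?_⟩
    obtain ⟨a, rfl⟩ := hrange v hvx
    exact ⟨a, hsingleton a fun ha => hvc (by rw [huniq ha hc])⟩
  · refine ⟨x, x, fun v hvx _ => ?_⟩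
    obtain ⟨a, rfl⟩ := hrange v hvx
    exact ⟨a, hsingleton a fun ha => hcov ⟨a, ha⟩⟩

/-- The vertices `wᵢ` and `oᵢ₊₂ʲ` of `Z` are not adjacent. -/
theorem not_Z_adj_inl_inr (i : Fin 3) (j : Fin 2) :
    ¬ Z.Adj (Sum.inl i) (Sum.inr (i + 2, j)) := by
  simp only [Z, SimpleGraph.fromRel_adj, ZRel]
  fin_cases i <;> simp

/-- Deleting any two vertices of `Z` leaves a pair of nonadjacent vertices. -/
theorem exists_not_Z_adj_avoiding (x y : ZVert) :
    ∃ u v, u ≠ v ∧ ¬ Z.Adj u v ∧ u ≠ x ∧ u ≠ y ∧ v ≠ x ∧ v ≠ y := by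
  have h : ∀ x y : ZVert, ∃ i : Fin 3, (Sum.inl i : ZVert) ≠ x ∧ (Sum.inl i : ZVert) ≠ y ∧
      (Sum.inr (i + 2, 0) : ZVert) ≠ x ∧ (Sum.inr (i + 2, 0) : ZVert) ≠ y := by
    decide
  obtain ⟨i, hi⟩ := h x y
  exact ⟨_, _, Sum.inl_ne_inr, not_Z_adj_inl_inr i 0, hi⟩

/-- A graph on `n` vertices that is not complete has fewer than `n.choose 2` edges. -/
theorem SimpleGraph.ncard_edgeSet_lt_choose_two {α : Type*} [Fintype α] {G : SimpleGraph α}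
    (hG : G ≠ ⊤) : G.edgeSet.ncard < (Fintype.card α).choose 2 := by
  classical
  rw [← SimpleGraph.card_edgeFinset_top_eq_card_choose_two, ← Set.ncard_coe_finset,
    SimpleGraph.coe_edgeFinset]
  exact Set.ncard_lt_ncard (SimpleGraph.edgeSet_ssubset_edgeSet.2 hG.lt_top)

/-- Every minor of `Z` with exactly `8` vertices has at most `27` edges. -/
theorem Z_minor_eight_vertices_edges_le {W : Type*} [Fintype W]
    (H : SimpleGraph W) (h8 : Fintype.card W = 8) (hminor : IsMinor H Z) :
    H.edgeSet.ncard ≤ 27 := by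
  obtain ⟨S, hconn, hdisj, hadj⟩ := hminor
  obtain ⟨x, y, hxy⟩ := exists_pair_forall_ne_eq_singleton (by simp [h8]) S
    (fun a => Set.nonempty_coe_sort.1 (hconn a).nonempty) hdisj
  obtain ⟨u, v, huv, hnadj, hux, huy, hvx, hvy⟩ := exists_not_Z_adj_avoiding x y
  obtain ⟨a, ha⟩ := hxy u hux huy
  obtain ⟨b, hb⟩ := hxy v hvx hvy
  have hab : a ≠ b := by
    rintro rfl
    exact huv (Set.singleton_injective (ha.symm.trans hb))
  have hH : H ≠ ⊤ := by
    rintro rfl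
    obtain ⟨p, hp, q, hq, hpq⟩ := hadj a b hab
    rw [ha, Set.mem_singleton_iff] at hp
    rw [hb, Set.mem_singleton_iff] at hq
    exact hnadj (hp ▸ hq ▸ hpq)
  have hlt := SimpleGraph.ncard_edgeSet_lt_choose_two hH
  rw [h8, show Nat.choose 8 2 = 28 from rfl] at hlt
  omega
end
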